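/- Let γ ∈ (1,2), let H : ℝ → ℝ be twice continuously differentiable with compact support contained in [a, 1-a] for some a ∈ (0,1), and define, for x ∈ {1,…,N−1}, (K_N H)(x/N) = ∑_{y ∈ ℤ} p(y−x)(H(y/N) − H(x/N)) with p(z) = c_γ|z|^{-(1+γ)}, p(0)=0. Then N^γ (K_N H)(x/N) converges, uniformly over x with x/N ∈ [a, 1−a], to −((-Δ)^{γ/2} H)(x/N) as N → ∞. -/

import Mathlib

open MeasureTheory

/-- The principal-value fractional Laplacian `((-Δ)^{γ/2} H)(q)` equals `L`. -/
def HasFracLapAt (c γ : ℝ) (H : ℝ → ℝ) (q L : ℝ) : Prop :=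
  Filter.Tendsto
    (fun ε : ℝ => c * ∫ y in {y : ℝ | ε ≤ |y - q|}, (H q - H y) * |y - q| ^ (-(1 + γ)))
    (nhdsWithin 0 (Set.Ioi 0)) (nhds L)

/-- The symmetric second difference of `H` at `q` with increment `u`. -/
def symmDiff2 (H : ℝ → ℝ) (q u : ℝ) : ℝ := H (q + u) + H (q - u) - 2 * H q

/-- The symmetrised integrand of the fractional Laplacian of order `s - 1`. -/
noncomputable def symmKernel (s : ℝ) (H : ℝ → ℝ) (q u : ℝ) : ℝ := symmDiff2 H q u * u ^ (-s)

/-- An antitone integrable majorant of `symmKernel`. -/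
noncomputable def kernelBound (C s u : ℝ) : ℝ := C * min (u ^ (2 - s)) (u ^ (-s))

lemma symmDiff2_bounds {H : ℝ → ℝ} (hH : ContDiff ℝ 2 H) (hsupp : HasCompactSupport H) :
    ∃ C : ℝ, 0 ≤ C ∧ (∀ x, |H x| ≤ C) ∧ (∀ q u, 0 ≤ u → |symmDiff2 H q u| ≤ C * u ^ 2) ∧
      (∀ q u, |symmDiff2 H q u| ≤ C) ∧
      ∀ q u v, |symmDiff2 H q u - symmDiff2 H q v| ≤ C * |u - v| := by
  obtain ⟨M, hM⟩ := hsupp.exists_bound_of_continuous hH.continuous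
  obtain ⟨K, hK⟩ := ContDiff.lipschitzWith_of_hasCompactSupport hsupp hH (by simp)
  have hH' : ContDiff ℝ 1 (deriv H) := by
    have : ContDiff ℝ (1 + 1) H := by simpa [one_add_one_eq_two] using hH
    exact (contDiff_succ_iff_deriv.1 this).2.2
  obtain ⟨K', hK'⟩ := ContDiff.lipschitzWith_of_hasCompactSupport hsupp.deriv hH' (by simp)
  have hd : ∀ x, HasDerivAt H (deriv H x) x :=
    fun x => (hH.differentiable (by simp)).differentiableAt.hasDerivAt
  have hM0 : 0 ≤ M := (norm_nonneg _).trans (hM 0)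
  have hK0 : (0 : ℝ) ≤ K := K.2
  have hK0' : (0 : ℝ) ≤ K' := K'.2
  refine ⟨4 * M + 2 * K + 2 * K', by positivity, fun x => ?_, fun q u hu => ?_, fun q u => ?_,
    fun q u v => ?_⟩
  · have := hM x
    rw [Real.norm_eq_abs] at this
    linarith
  · have hder : ∀ x, HasDerivAt (symmDiff2 H q) (deriv H (q + x) - deriv H (q - x)) x := by
      intro x
      have h1 := (hd (q + x)).comp x ((hasDerivAt_id x).const_add q)
      have h2 := (hd (q - x)).comp x ((hasDerivAt_id x).const_sub q)
      exact ((h1.add h2).sub_const (2 * H q)).congr_deriv (by ring)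
    have hb : ∀ x ∈ Set.Ico 0 u, ‖deriv H (q + x) - deriv H (q - x)‖ ≤ 2 * K' * u := by
      intro x hx
      have := hK'.norm_sub_le (q + x) (q - x)
      have e : ‖q + x - (q - x)‖ = 2 * x := by
        rw [show q + x - (q - x) = 2 * x by ring, Real.norm_eq_abs,
          abs_of_nonneg (by linarith [hx.1])]
      rw [e] at this
      nlinarith [hx.2, hx.1]
    have := norm_image_sub_le_of_norm_deriv_le_segment'
      (fun x _ => (hder x).hasDerivWithinAt) hb u ⟨hu, le_rfl⟩
    have h0 : symmDiff2 H q 0 = 0 := by simp [symmDiff2]; ring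
    rw [h0, sub_zero, sub_zero, Real.norm_eq_abs] at this
    nlinarith [sq_nonneg u, mul_nonneg hM0 (sq_nonneg u), mul_nonneg hK0 (sq_nonneg u)]
  · have h1 := hM (q + u)
    have h2 := hM (q - u)
    have h3 := hM q
    rw [Real.norm_eq_abs, abs_le] at h1 h2 h3
    rw [symmDiff2, abs_le]
    constructor <;> linarith [h1.1, h1.2, h2.1, h2.2, h3.1, h3.2]
  · have h1 := hK.norm_sub_le (q + u) (q + v)
    have h2 := hK.norm_sub_le (q - u) (q - v)
    rw [show q + u - (q + v) = u - v by ring, Real.norm_eq_abs, Real.norm_eq_abs] at h1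
    rw [show q - u - (q - v) = -(u - v) by ring, Real.norm_eq_abs, Real.norm_eq_abs, abs_neg] at h2
    have : symmDiff2 H q u - symmDiff2 H q v
        = (H (q + u) - H (q + v)) + (H (q - u) - H (q - v)) := by simp only [symmDiff2]; ring
    rw [this]
    have := abs_add_le (H (q + u) - H (q + v)) (H (q - u) - H (q - v))
    nlinarith [abs_nonneg (u - v), mul_nonneg hM0 (abs_nonneg (u - v)),
      mul_nonneg hK0' (abs_nonneg (u - v))]

lemma measurable_symmKernel {H : ℝ → ℝ} (hH : Continuous H) (s q : ℝ) :
    Measurable (symmKernel s H q) := by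
  have := hH.measurable
  unfold symmKernel symmDiff2
  fun_prop

lemma measurable_ceil_mul_div (N : ℕ) : Measurable fun u : ℝ => (⌈u * N⌉₊ / N : ℝ) := by
  have hcast : Measurable (fun n : ℕ => (n : ℝ)) := measurable_from_top
  exact (hcast.comp (Nat.measurable_ceil.comp (measurable_id.mul_const _))).div_const _

lemma kernelBound_integrableOn (C : ℝ) {s : ℝ} (hs : 2 < s) (hs' : s < 3) :
    IntegrableOn (kernelBound C s) (Set.Ioi 0) := by
  have hmeas : Measurable (kernelBound C s) := by unfold kernelBound; fun_prop
  have hnn : ∀ u > 0, ‖kernelBound C s u‖ = |C| * min (u ^ (2 - s)) (u ^ (-s)) := by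
    intro u hu
    rw [kernelBound, norm_mul, Real.norm_eq_abs, Real.norm_eq_abs,
      abs_of_nonneg (a := min _ _) (by positivity)]
  rw [← Set.Ioc_union_Ioi_eq_Ioi (zero_le_one' ℝ)]
  refine IntegrableOn.union ?_ ?_
  · have := (intervalIntegrable_iff_integrableOn_Ioc_of_le (zero_le_one' ℝ)).1
      (intervalIntegral.intervalIntegrable_rpow' (a := 0) (b := 1) (r := 2 - s) (by linarith))
    refine (this.const_mul |C|).mono' hmeas.aestronglyMeasurable ?_
    filter_upwards [ae_restrict_mem measurableSet_Ioc] with u hu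
    rw [hnn u hu.1]
    gcongr
    exact min_le_left _ _
  · have := integrableOn_Ioi_rpow_of_lt (a := -s) (c := 1) (by linarith) one_pos
    refine (this.const_mul |C|).mono' hmeas.aestronglyMeasurable ?_
    filter_upwards [ae_restrict_mem measurableSet_Ioi] with u hu
    rw [hnn u (one_pos.trans hu)]
    gcongr
    exact min_le_right _ _

lemma kernelBound_anti {C s u v : ℝ} (hC : 0 ≤ C) (hs : 2 < s) (hu : 0 < u) (huv : u ≤ v) :
    kernelBound C s v ≤ kernelBound C s u := by
  unfold kernelBound
  refine mul_le_mul_of_nonneg_left (min_le_min ?_ ?_) hC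
  · exact Real.rpow_le_rpow_of_nonpos hu huv (by linarith)
  · exact Real.rpow_le_rpow_of_nonpos hu huv (by linarith)

lemma abs_symmKernel_le {H : ℝ → ℝ} {C s q u : ℝ} (hu : 0 < u)
    (h2 : |symmDiff2 H q u| ≤ C * u ^ 2) (h0 : |symmDiff2 H q u| ≤ C) :
    |symmKernel s H q u| ≤ kernelBound C s u := by
  have hC : 0 ≤ C := (abs_nonneg _).trans h0
  have hp : 0 < u ^ (-s) := Real.rpow_pos_of_pos hu _
  rw [symmKernel, kernelBound, abs_mul, abs_of_pos hp, mul_min_of_nonneg _ _ hC]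
  refine le_min ?_ (by gcongr)
  have : u ^ (2 - s) = u ^ 2 * u ^ (-s) := by
    rw [sub_eq_add_neg, Real.rpow_add hu]; norm_cast
  rw [this, ← mul_assoc]
  gcongr

/-- A right-endpoint Riemann sum is the integral of a step function. -/
lemma hasSum_integral_ceil {f : ℝ → ℝ} {N : ℕ} (hN : 0 < N)
    (hf : IntegrableOn (fun u : ℝ => f (⌈u * N⌉₊ / N)) (Set.Ioi 0)) :
    HasSum (fun n : ℕ => (N : ℝ)⁻¹ * f ((n + 1 : ℕ) / N))
      (∫ u in Set.Ioi (0 : ℝ), f (⌈u * N⌉₊ / N)) := by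
  have hN' : (0 : ℝ) < N := by exact_mod_cast hN
  have hmem : ∀ (n : ℕ) (u : ℝ), u ∈ Set.Ioc ((n : ℝ) / N) ((n + 1 : ℕ) / N) ↔
      ⌈u * N⌉₊ = n + 1 := by
    intro n u
    rw [Nat.ceil_eq_iff (Nat.succ_ne_zero n), Set.mem_Ioc, div_lt_iff₀ hN', le_div_iff₀ hN']
    simp
  have hunion : (⋃ n : ℕ, Set.Ioc ((n : ℝ) / N) ((n + 1 : ℕ) / N)) = Set.Ioi 0 := by
    ext u
    simp only [Set.mem_iUnion, hmem, Set.mem_Ioi]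
    constructor
    · rintro ⟨n, hn⟩
      have : 0 < ⌈u * N⌉₊ := by omega
      rw [Nat.ceil_pos] at this
      exact pos_of_mul_pos_left this hN'.le
    · intro hu
      have : 0 < ⌈u * N⌉₊ := Nat.ceil_pos.2 (by positivity)
      exact ⟨⌈u * N⌉₊ - 1, by omega⟩
  rw [← hunion] at hf ⊢
  have := hasSum_integral_iUnion (fun n : ℕ => measurableSet_Ioc) (fun m n hmn => by
    rw [Function.onFun, Set.disjoint_left]
    intro u hm hn
    rw [hmem] at hm hn
    omega) hf
  have hval : ∀ n : ℕ, (N : ℝ)⁻¹ * f ((n + 1 : ℕ) / N) =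
      ∫ u in Set.Ioc ((n : ℝ) / N) ((n + 1 : ℕ) / N), f (⌈u * N⌉₊ / N) := by
    intro n
    rw [setIntegral_congr_fun (g := fun _ => f ((n + 1 : ℕ) / N)) measurableSet_Ioc
      fun u hu => by simp only [(hmem n u).1 hu], setIntegral_const, Real.volume_real_Ioc_of_le
      (by gcongr; simp), smul_eq_mul]
    congr 1
    push_cast
    field_simp
    ring
  simpa only [hval] using this

lemma integral_truncated_eq {H : ℝ → ℝ} (hH : Continuous H) {M s : ℝ} (hM : ∀ x, |H x| ≤ M)
    (hs : 2 < s) (q : ℝ) {ε : ℝ} (hε : 0 < ε) :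
    ∫ y in {y : ℝ | ε ≤ |y - q|}, (H q - H y) * |y - q| ^ (-s)
      = ∫ u in Set.Ici ε, -symmKernel s H q u := by
  set F : ℝ → ℝ := fun u => (H q - H (q + u)) * |u| ^ (-s) with hF
  have hFm : Measurable F := by
    have := hH.measurable
    fun_prop
  have hset : {u : ℝ | ε ≤ |u|} = Set.Iic (-ε) ∪ Set.Ici ε := by
    ext u
    simp only [Set.mem_ofPred_eq, le_abs, Set.mem_union, Set.mem_Iic, Set.mem_Ici]
    rw [or_comm, le_neg]
  have hint : ∀ G : ℝ → ℝ, Measurable G → (∀ u > 0, |G u| ≤ 2 * M * u ^ (-s)) →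
      IntegrableOn G (Set.Ioi ε) := by
    intro G hG hb
    have := integrableOn_Ioi_rpow_of_lt (a := -s) (c := ε) (by linarith) hε
    refine (this.const_mul (2 * M)).mono' hG.aestronglyMeasurable ?_
    filter_upwards [ae_restrict_mem measurableSet_Ioi] with u hu
    exact hb u (hε.trans hu)
  have hFb : ∀ u, |F u| ≤ 2 * M * |u| ^ (-s) := by
    intro u
    rw [hF, abs_mul, abs_of_nonneg (Real.rpow_nonneg (abs_nonneg u) _)]
    gcongr
    have := abs_sub (H q) (H (q + u))
    linarith [hM q, hM (q + u)]
  have h1 : IntegrableOn F (Set.Ioi ε) := hint F hFm fun u hu => by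
    simpa [abs_of_pos hu] using hFb u
  have h2 : IntegrableOn (fun u => F (-u)) (Set.Ioi ε) := hint _ (by fun_prop) fun u hu => by
    simpa [abs_of_pos hu] using hFb (-u)
  have h3 : IntegrableOn F (Set.Iic (-ε)) := by
    have := (integrableOn_Ici_iff_integrableOn_Ioi (by finiteness)).2 h2
    have h := (Measure.measurePreserving_neg (volume : Measure ℝ)).integrableOn_comp_preimage
      (MeasurableEquiv.neg ℝ).measurableEmbedding (f := F) (s := Set.Iic (-ε))
    rw [← h]
    simpa [Function.comp_def] using this
  have htrans : ∫ y in {y : ℝ | ε ≤ |y - q|}, (H q - H y) * |y - q| ^ (-s)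
      = ∫ u in {u : ℝ | ε ≤ |u|}, F u := by
    rw [← integral_indicator (by measurability), ← integral_indicator (by measurability),
      ← integral_add_left_eq_self _ q]
    congr 1
    ext y
    simp [Set.indicator, hF]
  rw [htrans, hset, setIntegral_union _ measurableSet_Ici h3
    ((integrableOn_Ici_iff_integrableOn_Ioi (by finiteness)).2 h1), ← integral_comp_neg_Ioi,
    integral_Ici_eq_integral_Ioi, integral_Ici_eq_integral_Ioi, ← integral_add h2 h1]
  · refine setIntegral_congr_fun measurableSet_Ioi fun u hu => ?_
    have hu : 0 < u := hε.trans hu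
    simp only [hF, symmKernel, symmDiff2, abs_neg, abs_of_pos hu, ← sub_eq_add_neg]
    ring
  · rw [Set.disjoint_left]
    intro u h1 h2
    rw [Set.mem_Iic] at h1
    rw [Set.mem_Ici] at h2
    linarith

lemma hasFracLapAt_eq {H : ℝ → ℝ} (hH : Continuous H) {c γ C q L : ℝ} (hγ : 1 < γ) (hγ' : γ < 2)
    (hM : ∀ x, |H x| ≤ C) (h2 : ∀ u, 0 ≤ u → |symmDiff2 H q u| ≤ C * u ^ 2)
    (h0 : ∀ u, |symmDiff2 H q u| ≤ C) (hL : HasFracLapAt c γ H q L) :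
    IntegrableOn (symmKernel (1 + γ) H q) (Set.Ioi 0) ∧
    L = -(c * ∫ u in Set.Ioi 0, symmKernel (1 + γ) H q u) := by
  have hm := measurable_symmKernel hH (1 + γ) q
  have hi : IntegrableOn (symmKernel (1 + γ) H q) (Set.Ioi 0) := by
    refine (kernelBound_integrableOn C (s := 1 + γ) (by linarith) (by linarith)).mono'
      hm.aestronglyMeasurable ?_
    filter_upwards [ae_restrict_mem measurableSet_Ioi] with u hu
    exact abs_symmKernel_le hu (h2 u (le_of_lt hu)) (h0 u)
  refine ⟨hi, ?_⟩
  have hlim : Filter.Tendsto (fun ε : ℝ => ε) (nhdsWithin 0 (Set.Ioi 0)) (nhds 0) :=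
    nhdsWithin_le_nhds
  have := (aecover_Ioi_of_Ici (μ := volume) hlim).integral_tendsto_of_countably_generated hi.neg
  have h3 := this.const_mul c
  refine (tendsto_nhds_unique hL (h3.congr' ?_)).trans ?_
  · filter_upwards [self_mem_nhdsWithin] with ε hε
    rw [integral_truncated_eq hH hM (by linarith) q hε, Measure.restrict_restrict measurableSet_Ici,
      Set.inter_eq_left.2 (Set.Ici_subset_Ioi.2 hε)]
    rfl
  · simp [integral_neg]

/-- Majorant, uniform in the base point, of the error of the step-function approximation. -/
noncomputable def stepError (C s : ℝ) (N : ℕ) (u : ℝ) : ℝ :=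
  min (2 * kernelBound C s u)
    (C * |(⌈u * N⌉₊ / N : ℝ) - u| * (⌈u * N⌉₊ / N : ℝ) ^ (-s)
      + C * |(⌈u * N⌉₊ / N : ℝ) ^ (-s) - u ^ (-s)|)

lemma stepError_nonneg {C s : ℝ} (hC : 0 ≤ C) (N : ℕ) {u : ℝ} (hu : 0 < u) :
    0 ≤ stepError C s N u := by
  unfold stepError kernelBound
  positivity

lemma stepError_measurable (C s : ℝ) (N : ℕ) : Measurable (stepError C s N) := by
  have h := measurable_ceil_mul_div N
  unfold stepError kernelBound
  fun_prop

lemma tendsto_integral_stepError {C s : ℝ} (hC : 0 ≤ C) (hs : 2 < s) (hs' : s < 3) :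
    Filter.Tendsto (fun N : ℕ => ∫ u in Set.Ioi 0, stepError C s N u) Filter.atTop (nhds 0) := by
  have := tendsto_integral_of_dominated_convergence (μ := volume.restrict (Set.Ioi (0 : ℝ)))
    (F := stepError C s) (f := fun _ => 0) (fun u => 2 * kernelBound C s u)
    (fun N => (stepError_measurable C s N).aestronglyMeasurable)
    ((kernelBound_integrableOn C hs hs').const_mul 2) ?_ ?_
  · simpa using this
  · intro N
    filter_upwards [ae_restrict_mem measurableSet_Ioi] with u hu
    rw [Real.norm_eq_abs, abs_of_nonneg (stepError_nonneg hC N hu)]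
    exact min_le_left _ _
  · filter_upwards [ae_restrict_mem measurableSet_Ioi] with u hu
    have hu : 0 < u := hu
    have hv : Filter.Tendsto (fun N : ℕ => (⌈u * N⌉₊ / N : ℝ)) Filter.atTop (nhds u) :=
      (tendsto_nat_ceil_mul_div_atTop hu.le).comp tendsto_natCast_atTop_atTop
    have hp := hv.rpow_const (p := -s) (Or.inl hu.ne')
    have h1 : Filter.Tendsto (fun N : ℕ => C * |(⌈u * N⌉₊ / N : ℝ) - u| *
        (⌈u * N⌉₊ / N : ℝ) ^ (-s) + C * |(⌈u * N⌉₊ / N : ℝ) ^ (-s) - u ^ (-s)|)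
        Filter.atTop (nhds 0) := by
      have := (((hv.sub_const u).abs.const_mul C).mul hp).add
        ((hp.sub_const (u ^ (-s))).abs.const_mul C)
      simpa using this
    refine squeeze_zero (fun N => stepError_nonneg hC N hu) (fun N => min_le_right _ _) h1

lemma riemann_sum_error {H : ℝ → ℝ} (hH : Continuous H) {C s q : ℝ} (hs : 2 < s) (hs' : s < 3)
    (h2 : ∀ u, 0 ≤ u → |symmDiff2 H q u| ≤ C * u ^ 2) (h0 : ∀ u, |symmDiff2 H q u| ≤ C)
    (hlip : ∀ u v, |symmDiff2 H q u - symmDiff2 H q v| ≤ C * |u - v|)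
    (hi : IntegrableOn (symmKernel s H q) (Set.Ioi 0)) {N : ℕ} (hN : 0 < N) :
    |(∑' n : ℕ, (N : ℝ)⁻¹ * symmKernel s H q ((n + 1 : ℕ) / N))
      - ∫ u in Set.Ioi 0, symmKernel s H q u| ≤ ∫ u in Set.Ioi 0, stepError C s N u := by
  have hN' : (0 : ℝ) < N := by exact_mod_cast hN
  have hC : 0 ≤ C := (abs_nonneg _).trans (h0 0)
  have hm := measurable_symmKernel hH s q
  have hv := measurable_ceil_mul_div N
  have hle : ∀ u : ℝ, u ≤ (⌈u * N⌉₊ / N : ℝ) := fun u => by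
    rw [le_div_iff₀ hN']
    exact Nat.le_ceil _
  have hb : ∀ u : ℝ, 0 < u → |symmKernel s H q u| ≤ kernelBound C s u := fun u hu =>
    abs_symmKernel_le hu (h2 u hu.le) (h0 u)
  have hb' : ∀ u : ℝ, 0 < u → |symmKernel s H q (⌈u * N⌉₊ / N)| ≤ kernelBound C s u := fun u hu =>
    (hb _ (hu.trans_le (hle u))).trans (kernelBound_anti hC hs hu (hle u))
  have hK := kernelBound_integrableOn C hs hs'
  have hstep : IntegrableOn (fun u : ℝ => symmKernel s H q (⌈u * N⌉₊ / N)) (Set.Ioi 0) := by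
    refine hK.mono' (hm.comp hv).aestronglyMeasurable ?_
    filter_upwards [ae_restrict_mem measurableSet_Ioi] with u hu
    exact hb' u hu
  rw [(hasSum_integral_ceil hN hstep).tsum_eq, ← integral_sub hstep hi]
  have hE : IntegrableOn (stepError C s N) (Set.Ioi 0) := by
    refine (hK.const_mul 2).mono' (stepError_measurable C s N).aestronglyMeasurable ?_
    filter_upwards [ae_restrict_mem measurableSet_Ioi] with u hu
    rw [Real.norm_eq_abs, abs_of_nonneg (stepError_nonneg hC N hu)]
    exact min_le_left _ _
  rw [← Real.norm_eq_abs]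
  refine norm_integral_le_of_norm_le hE ?_
  filter_upwards [ae_restrict_mem measurableSet_Ioi] with u hu
  have hu : 0 < u := hu
  rw [Real.norm_eq_abs]
  refine le_min ?_ ?_
  · have := abs_sub (symmKernel s H q (⌈u * N⌉₊ / N)) (symmKernel s H q u)
    linarith [hb u hu, hb' u hu]
  · set v : ℝ := ⌈u * N⌉₊ / N
    have hvp : 0 < v ^ (-s) := Real.rpow_pos_of_pos (hu.trans_le (hle u)) _
    have e : symmKernel s H q v - symmKernel s H q u =
        (symmDiff2 H q v - symmDiff2 H q u) * v ^ (-s)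
          + symmDiff2 H q u * (v ^ (-s) - u ^ (-s)) := by
      simp only [symmKernel]; ring
    rw [e]
    refine (abs_add_le _ _).trans ?_
    rw [abs_mul, abs_mul, abs_of_pos hvp]
    gcongr
    · exact hlip v u
    · exact h0 u

lemma lattice_sum_eq {H : ℝ → ℝ} {M c γ : ℝ} (hM : ∀ x, |H x| ≤ M) (hγ : 1 < γ)
    {p : ℤ → ℝ} (hp0 : p 0 = 0) (hp : ∀ z : ℤ, z ≠ 0 → p z = c * |(z : ℝ)| ^ (-(1 + γ)))
    {N : ℕ} (hN : 0 < N) (x : ℕ) :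
    (N : ℝ) ^ γ * (∑' y : ℤ, p (y - (x : ℤ)) * (H ((y : ℝ) / N) - H ((x : ℝ) / N)))
      = c * ∑' n : ℕ, (N : ℝ)⁻¹ * symmKernel (1 + γ) H (x / N) ((n + 1 : ℕ) / N) := by
  have hN' : (0 : ℝ) < N := by exact_mod_cast hN
  have hp' : ∀ z : ℤ, p z = c * |(z : ℝ)| ^ (-(1 + γ)) := by
    intro z
    by_cases hz : z = 0
    · rw [hz, hp0, Int.cast_zero, abs_zero, Real.zero_rpow (by linarith), mul_zero]
    · exact hp z hz
  set f : ℤ → ℝ := fun z => p z * (H (x / N + z / N) - H (x / N)) with hf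
  have hshift : ∑' y : ℤ, p (y - (x : ℤ)) * (H ((y : ℝ) / N) - H ((x : ℝ) / N)) = ∑' z, f z := by
    rw [← (Equiv.addRight (x : ℤ)).tsum_eq]
    refine tsum_congr fun z => ?_
    simp only [Equiv.coe_addRight, hf, add_sub_cancel_right]
    push_cast
    rw [add_div, add_comm ((z : ℝ) / N)]
  have hsum : Summable f := by
    refine Summable.of_norm_bounded
      ((Real.summable_abs_int_rpow (b := 1 + γ) (by linarith)).mul_left (|c| * (2 * M))) fun z => ?_
    have h1 := abs_sub (H (x / N + z / N)) (H (x / N))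
    have h2 : |H (x / N + z / N) - H (x / N)| ≤ 2 * M := by
      linarith [hM (x / N + z / N), hM (x / N)]
    simp only [hf]
    rw [hp', Real.norm_eq_abs, abs_mul, abs_mul,
      abs_of_nonneg (Real.rpow_nonneg (abs_nonneg (z : ℝ)) _)]
    nlinarith [mul_le_mul_of_nonneg_left h2
      (mul_nonneg (abs_nonneg c) (Real.rpow_nonneg (abs_nonneg (z : ℝ)) (-(1 + γ))))]
  have hf0 : f 0 = 0 := by simp [hf, hp0]
  have hs := hsum.hasSum.nat_add_neg
  rw [hf0, add_zero] at hs
  rw [hshift, ← hs.tsum_eq, hs.summable.tsum_eq_zero_add]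
  simp only [Nat.cast_zero, neg_zero, hf0, add_zero, zero_add]
  rw [← tsum_mul_left, ← tsum_mul_left]
  refine tsum_congr fun n => ?_
  have hn : (0 : ℝ) < ((n + 1 : ℕ) : ℝ) := by positivity
  simp only [hf, hp', symmKernel, symmDiff2, Int.cast_neg, Int.cast_natCast, abs_neg,
    abs_of_pos hn, neg_div, ← sub_eq_add_neg]
  rw [Real.div_rpow hn.le hN'.le, Real.rpow_neg hN'.le (1 + γ), Real.rpow_add hN', Real.rpow_one]
  field_simp
  ring

theorem stmt_14 (γ c : ℝ) (hγ : γ ∈ Set.Ioo (1 : ℝ) 2) (hc : 0 < c)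
    (a : ℝ) (ha : a ∈ Set.Ioo (0 : ℝ) 1)
    (H : ℝ → ℝ) (hH : ContDiff ℝ 2 H) (hsupp : HasCompactSupport H)
    (hsupp' : tsupport H ⊆ Set.Icc a (1 - a))
    (p : ℤ → ℝ) (hp0 : p 0 = 0)
    (hp : ∀ z : ℤ, z ≠ 0 → p z = c * |(z : ℝ)| ^ (-(1 + γ)))
    (L : ℝ → ℝ) (hL : ∀ q : ℝ, HasFracLapAt c γ H q (L q)) :
    ∀ δ > 0, ∃ N₀ : ℕ, ∀ N : ℕ, N₀ ≤ N → ∀ x : ℕ, 1 ≤ x → x ≤ N - 1 →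
      a ≤ (x : ℝ) / N → (x : ℝ) / N ≤ 1 - a →
      |(N : ℝ) ^ γ * (∑' y : ℤ, p (y - (x : ℤ)) * (H ((y : ℝ) / N) - H ((x : ℝ) / N)))
          + L ((x : ℝ) / N)| ≤ δ := by
  intro δ hδ
  obtain ⟨hγ1, hγ2⟩ := hγ
  obtain ⟨C, hC, hM, h2, h0, hlip⟩ := symmDiff2_bounds hH hsupp
  have ht := (tendsto_integral_stepError hC (s := 1 + γ) (by linarith) (by linarith)).const_mul c
  rw [mul_zero] at ht
  obtain ⟨N₀, hN₀⟩ := Filter.eventually_atTop.1 (ht.eventually_le_const hδ)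
  refine ⟨N₀, fun N hN x hx hxN _ _ => ?_⟩
  have hNpos : 0 < N := by omega
  obtain ⟨hi, hLq⟩ := hasFracLapAt_eq hH.continuous hγ1 hγ2 hM (h2 _) (h0 _) (hL (x / N))
  rw [lattice_sum_eq hM hγ1 hp0 hp hNpos x, hLq, ← sub_eq_add_neg, ← mul_sub, abs_mul,
    abs_of_pos hc]
  exact (mul_le_mul_of_nonneg_left (riemann_sum_error hH.continuous (by linarith) (by linarith)
    (h2 _) (h0 _) (hlip _) hi hNpos) hc.le).trans (hN₀ N hN)
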